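/- Let θ be a real antisymmetric 4 × 4 matrix. The tempered distribution u on ℝ⁴ × ℝ⁴ defined by u(g) := (2π)^{−6} ∫_{ℝ³×ℝ³} e^{−i⟨p̃, θ k̃⟩} · g( (ω(k), k), (ω(p), p) ) / (4 ω(k) ω(p)) dk dp, where k̃ = (ω(k), k) and p̃ = (ω(p), p) are the on-shell momenta, is a well-defined continuous linear functional on the Schwartz space 𝒮(ℝ⁸), and its support is contained in the product of the closed forward light cones, {(q, r) ∈ ℝ⁴ × ℝ⁴ : q₀ ≥ |q⃗| and r₀ ≥ |r⃗|}. -/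

import Mathlib

open MeasureTheory

/-- The on-shell energy `ω(k) = √(|k|² + m²)` for `k ∈ ℝ³`. -/
noncomputable def omega (m : ℝ) (k : Fin 3 → ℝ) : ℝ :=
  Real.sqrt ((∑ i, k i ^ 2) + m ^ 2)

/-- The on-shell four-momentum `k̃ = (ω(k), k) ∈ ℝ⁴`. -/
noncomputable def onShell (m : ℝ) (k : Fin 3 → ℝ) : Fin 4 → ℝ :=
  ![omega m k, k 0, k 1, k 2]

/-- The on-shell twisting pairing `⟨p̃, θ k̃⟩ = p̃ · (θ k̃)`. -/
noncomputable def twist (m : ℝ) (θ : Matrix (Fin 4) (Fin 4) ℝ) (k p : Fin 3 → ℝ) : ℝ :=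
  ∑ i : Fin 4, onShell m p i * ∑ j : Fin 4, θ i j * onShell m k j

/-- The product of closed forward light cones in `ℝ⁴ × ℝ⁴`. -/
noncomputable def closedConeSq : Set ((ℝ × (Fin 3 → ℝ)) × (ℝ × (Fin 3 → ℝ))) :=
  {qr | Real.sqrt (∑ i, qr.1.2 i ^ 2) ≤ qr.1.1 ∧ Real.sqrt (∑ i, qr.2.2 i ^ 2) ≤ qr.2.1}

open scoped SchwartzMap

section WeightedPullback

variable {D E : Type*} [NormedAddCommGroup D] [NormedAddCommGroup E] [NormedSpace ℝ E]
  {γ : D → E} {w : D → ℂ} {C : ℝ}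

/-- A Schwartz function evaluated along a norm-increasing map decays rapidly. -/
theorem SchwartzMap.norm_comp_le_of_norm_le (hγ : ∀ x, ‖x‖ ≤ ‖γ x‖) (g : 𝓢(E, ℂ)) (n : ℕ)
    (x : D) :
    ‖g (γ x)‖ ≤ (1 + ‖x‖) ^ (-(n : ℝ)) *
      (2 ^ n * ((Finset.Iic (n, 0)).sup (schwartzSeminormFamily ℂ E ℂ)) g) := by
  rw [Real.rpow_neg (by positivity), ← div_eq_inv_mul, le_div_iff₀' (by positivity),
    Real.rpow_natCast]
  have h := SchwartzMap.one_add_le_sup_seminorm_apply (𝕜 := ℂ) (m := (n, 0)) (k := n) (n := 0)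
    le_rfl le_rfl g (γ x)
  rw [norm_iteratedFDeriv_zero] at h
  refine le_trans ?_ h
  gcongr
  exact hγ x

theorem SchwartzMap.norm_mul_comp_le (hγ : ∀ x, ‖x‖ ≤ ‖γ x‖) (hC : ∀ x, ‖w x‖ ≤ C)
    (g : 𝓢(E, ℂ)) (n : ℕ) (x : D) :
    ‖w x * g (γ x)‖ ≤ (1 + ‖x‖) ^ (-(n : ℝ)) *
      (C * (2 ^ n * ((Finset.Iic (n, 0)).sup (schwartzSeminormFamily ℂ E ℂ)) g)) := by
  have hC0 : 0 ≤ C := (norm_nonneg _).trans (hC x)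
  rw [norm_mul, mul_left_comm]
  exact mul_le_mul (hC x) (g.norm_comp_le_of_norm_le hγ n x) (norm_nonneg _) hC0

variable [MeasurableSpace D] [OpensMeasurableSpace D]
  {μ : Measure D} [hμ : μ.HasTemperateGrowth]

theorem SchwartzMap.integrable_mul_comp (hγc : Continuous γ) (hγ : ∀ x, ‖x‖ ≤ ‖γ x‖)
    (hw : Continuous w) (hC : ∀ x, ‖w x‖ ≤ C) (g : 𝓢(E, ℂ)) :
    Integrable (fun x => w x * g (γ x)) μ := by
  obtain ⟨n, hn⟩ := hμ.exists_integrable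
  exact (hn.mul_const _).mono' (hw.mul (g.continuous.comp hγc)).aestronglyMeasurable
    (.of_forall (g.norm_mul_comp_le hγ hC n))

/-- Integration of a Schwartz function along a norm-increasing map against a bounded weight is a
tempered distribution. -/
theorem SchwartzMap.exists_clm_integral_mul_comp (hγc : Continuous γ) (hγ : ∀ x, ‖x‖ ≤ ‖γ x‖)
    (hw : Continuous w) (hC : ∀ x, ‖w x‖ ≤ C) :
    ∃ u : 𝓢(E, ℂ) →L[ℂ] ℂ, ∀ g : 𝓢(E, ℂ), u g = ∫ x, w x * g (γ x) ∂μ := by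
  have hint := SchwartzMap.integrable_mul_comp (μ := μ) hγc hγ hw hC
  have hC0 : 0 ≤ C := (norm_nonneg _).trans (hC 0)
  refine ⟨SchwartzMap.mkCLMtoNormedSpace (fun g : 𝓢(E, ℂ) => ∫ x, w x * g (γ x) ∂μ)
    (fun f g => ?_) (fun a f => ?_) ?_, fun _ => rfl⟩
  · rw [← integral_add (hint f) (hint g)]
    simp [mul_add]
  · rw [RingHom.id_apply, smul_eq_mul, ← integral_const_mul]
    simp [mul_left_comm]
  · obtain ⟨n, hn⟩ := hμ.exists_integrable
    refine ⟨Finset.Iic (n, 0), (∫ x : D, (1 + ‖x‖) ^ (-(n : ℝ)) ∂μ) * C * 2 ^ n,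
      by positivity, fun f => ?_⟩
    refine (norm_integral_le_of_norm_le (hn.mul_const _)
      (.of_forall (f.norm_mul_comp_le hγ hC n))).trans_eq ?_
    rw [integral_mul_const]
    ring

end WeightedPullback

section MassShell

variable {m : ℝ}

theorem continuous_omega : Continuous (omega m) := by
  unfold omega
  fun_prop

theorem continuous_onShell : Continuous (onShell m) := by
  have h : Continuous (omega m) := continuous_omega
  refine continuous_pi fun i => ?_
  fin_cases i <;> simp [onShell] <;> fun_prop

theorem continuous_twist (θ : Matrix (Fin 4) (Fin 4) ℝ) :
    Continuous fun kp : (Fin 3 → ℝ) × (Fin 3 → ℝ) => twist m θ kp.1 kp.2 := by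
  have h : Continuous (onShell m) := continuous_onShell
  unfold twist
  fun_prop

theorem le_omega (k : Fin 3 → ℝ) : m ≤ omega m k :=
  Real.le_sqrt_of_sq_le (le_add_of_nonneg_left (by positivity))

theorem sqrt_sum_sq_le_omega (k : Fin 3 → ℝ) : √(∑ i, k i ^ 2) ≤ omega m k :=
  Real.sqrt_le_sqrt (le_add_of_nonneg_right (sq_nonneg m))

/-- The density of the twisted product of two mass shell measures. -/
noncomputable def twistWeight (m : ℝ) (θ : Matrix (Fin 4) (Fin 4) ℝ)
    (kp : (Fin 3 → ℝ) × (Fin 3 → ℝ)) : ℂ :=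
  Complex.exp (-Complex.I * ((twist m θ kp.1 kp.2 : ℝ) : ℂ)) /
    (4 * (omega m kp.1 : ℂ) * (omega m kp.2 : ℂ))

theorem continuous_twistWeight (hm : 0 < m) (θ : Matrix (Fin 4) (Fin 4) ℝ) :
    Continuous (twistWeight m θ) := by
  have hω : Continuous (omega m) := continuous_omega
  have ht := continuous_twist (m := m) θ
  have h0 (k : Fin 3 → ℝ) : (omega m k : ℂ) ≠ 0 :=
    Complex.ofReal_ne_zero.2 (hm.trans_le (le_omega (m := m) k)).ne'
  unfold twistWeight
  refine Continuous.div (by fun_prop) (by fun_prop) fun kp => ?_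
  simp [h0]

theorem norm_twistWeight_le (hm : 0 < m) (θ : Matrix (Fin 4) (Fin 4) ℝ)
    (kp : (Fin 3 → ℝ) × (Fin 3 → ℝ)) : ‖twistWeight m θ kp‖ ≤ 1 / (4 * m * m) := by
  have h1 := le_omega (m := m) kp.1
  have h2 := le_omega (m := m) kp.2
  have hexp : ‖Complex.exp (-Complex.I * ((twist m θ kp.1 kp.2 : ℝ) : ℂ))‖ = 1 := by
    simp [Complex.norm_exp]
  rw [twistWeight, norm_div, hexp, norm_mul, norm_mul, Complex.norm_real, Complex.norm_real,
    Real.norm_of_nonneg (hm.le.trans h1), Real.norm_of_nonneg (hm.le.trans h2),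
    Complex.norm_ofNat]
  have h3 : 0 < omega m kp.1 := hm.trans_le h1
  gcongr

theorem norm_le_norm_massShell (kp : (Fin 3 → ℝ) × (Fin 3 → ℝ)) :
    ‖kp‖ ≤ ‖((omega m kp.1, kp.1), (omega m kp.2, kp.2))‖ := by
  simp only [Prod.norm_def]
  exact max_le_max (le_max_right _ _) (le_max_right _ _)

end MassShell

/-- For a real antisymmetric `4 × 4` matrix `θ`, the functional
`u(g) = (2π)⁻⁶ ∫∫ e^{−i⟨p̃,θk̃⟩} g((ω(k),k),(ω(p),p))/(4ω(k)ω(p)) dk dp`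
(the Fourier transform of the twisted tensor product `Δ₊^{(⋆2)}`) is a well-defined
continuous linear functional on `𝒮(ℝ⁸)`, and its support is contained in the product of
the closed forward light cones. -/
theorem twisted_fourier_support (m : ℝ) (hm : 0 < m)
    (θ : Matrix (Fin 4) (Fin 4) ℝ) (hθ : θ.transpose = -θ) :
    (∀ g : SchwartzMap ((ℝ × (Fin 3 → ℝ)) × (ℝ × (Fin 3 → ℝ))) ℂ,
      Integrable (fun kp : (Fin 3 → ℝ) × (Fin 3 → ℝ) =>
        Complex.exp (-Complex.I * ((twist m θ kp.1 kp.2 : ℝ) : ℂ)) *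
          g ((omega m kp.1, kp.1), (omega m kp.2, kp.2)) /
          (4 * (omega m kp.1 : ℂ) * (omega m kp.2 : ℂ)))) ∧
    ∃ u : SchwartzMap ((ℝ × (Fin 3 → ℝ)) × (ℝ × (Fin 3 → ℝ))) ℂ →L[ℂ] ℂ,
      (∀ g : SchwartzMap ((ℝ × (Fin 3 → ℝ)) × (ℝ × (Fin 3 → ℝ))) ℂ,
        u g = ((((2 * Real.pi) ^ 6)⁻¹ : ℝ) : ℂ) *
          ∫ kp : (Fin 3 → ℝ) × (Fin 3 → ℝ),
            Complex.exp (-Complex.I * ((twist m θ kp.1 kp.2 : ℝ) : ℂ)) *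
              g ((omega m kp.1, kp.1), (omega m kp.2, kp.2)) /
              (4 * (omega m kp.1 : ℂ) * (omega m kp.2 : ℂ))) ∧
      (∀ g : SchwartzMap ((ℝ × (Fin 3 → ℝ)) × (ℝ × (Fin 3 → ℝ))) ℂ,
        Disjoint (tsupport (g : ((ℝ × (Fin 3 → ℝ)) × (ℝ × (Fin 3 → ℝ))) → ℂ)) closedConeSq →
          u g = 0) := by
  have hω : Continuous (omega m) := continuous_omega
  have hγc : Continuous fun kp : (Fin 3 → ℝ) × (Fin 3 → ℝ) =>
      ((omega m kp.1, kp.1), (omega m kp.2, kp.2)) := by fun_prop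
  have hw := continuous_twistWeight hm θ
  have hC := norm_twistWeight_le hm θ
  have heq (g : SchwartzMap ((ℝ × (Fin 3 → ℝ)) × (ℝ × (Fin 3 → ℝ))) ℂ) :
      (fun kp : (Fin 3 → ℝ) × (Fin 3 → ℝ) =>
        Complex.exp (-Complex.I * ((twist m θ kp.1 kp.2 : ℝ) : ℂ)) *
          g ((omega m kp.1, kp.1), (omega m kp.2, kp.2)) /
          (4 * (omega m kp.1 : ℂ) * (omega m kp.2 : ℂ))) =
      fun kp => twistWeight m θ kp * g ((omega m kp.1, kp.1), (omega m kp.2, kp.2)) :=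
    funext fun _ => mul_div_right_comm _ _ _
  simp only [heq]
  have hvol : (volume : Measure ((Fin 3 → ℝ) × (Fin 3 → ℝ))).IsAddHaarMeasure :=
    Measure.prod.instIsAddHaarMeasure volume volume
  refine ⟨SchwartzMap.integrable_mul_comp hγc norm_le_norm_massShell hw hC, ?_⟩
  obtain ⟨u, hu⟩ := SchwartzMap.exists_clm_integral_mul_comp (μ := volume) hγc
    norm_le_norm_massShell hw hC
  refine ⟨((((2 * Real.pi) ^ 6)⁻¹ : ℝ) : ℂ) • u, fun g => ?_, fun g hg => ?_⟩
  · rw [smul_apply, hu, smul_eq_mul]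
  · have hzero (kp : (Fin 3 → ℝ) × (Fin 3 → ℝ)) :
        g ((omega m kp.1, kp.1), (omega m kp.2, kp.2)) = 0 :=
      image_eq_zero_of_notMem_tsupport fun h => Set.disjoint_left.1 hg h
        ⟨sqrt_sum_sq_le_omega kp.1, sqrt_sum_sq_le_omega kp.2⟩
    simp [hu, hzero]
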